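/- Let q, Q be integers with 2 < q ≤ Q ≤ Q(q), where Q(q) = ⌊(2√(q−1) + 1 + √(4√(q−1) + 1))²/4⌋ + 1, and let λ* > 2√(Q−1) be the unique solution of the secular equation (1 − a(λ)²)/(1 − a(λ)√(q−1))² = μ(λ), where a(λ) = λ(1 − √(1 − 4(Q−1)/λ²))/(2(Q−1)) and μ(λ) = λ(Q−2 + Q√(1 − 4(Q−1)/λ²))/(2(Q−1)); then λ* = ‖A_{𝔾^{Q,q}}‖. Fix a root 0 ∈ S and define φ_{1/2}(y) := (1 + ((q−2)/q)·d(y,0))·(q−1)^{−d(y,0)/2} for y ∈ S. Then the function v on the vertices of 𝔾^Q given by v(x) := a(λ*)^{d(x,S)} · φ_{1/2}(y(x)), where y(x) is the unique vertex of S closest to x, is a generalized Perron–Frobenius eigenvector of A_{𝔾^{Q,q}}: v has strictly positive entries and Σ_y (A_{𝔾^{Q,q}})_{xy} v(y) = λ* v(x) for every vertex x. -/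

import Mathlib

open Filter MeasureTheory Set
open scoped Topology Classical ENNReal

noncomputable section

/-- The Hilbert space ℓ²(V) with complex coefficients. -/
abbrev L2 (V : Type) := lp (fun _ : V => ℂ) 2

/-- The coordinate (delta) vector at a vertex `x`. -/
def delta {V : Type} (x : V) : L2 V :=
  haveI := Classical.decEq V; lp.single 2 x 1

/-- The matrix entry `B_{x y} = (B δ_y)(x)` of a bounded operator on ℓ²(V). -/
def entry {V : Type} (B : L2 V →L[ℂ] L2 V) (x y : V) : ℂ :=
  (B (delta y) : ∀ _ : V, ℂ) x

/-- The resolvent `R_B(z) = (z·1 − B)⁻¹` (junk value if not invertible). -/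
def Res {V : Type} (B : L2 V →L[ℂ] L2 V) (z : ℂ) : L2 V →L[ℂ] L2 V :=
  Ring.inverse (z • (1 : L2 V →L[ℂ] L2 V) - B)

/-- The resolvent at a real point. -/
def ResR {V : Type} (B : L2 V →L[ℂ] L2 V) (l : ℝ) : L2 V →L[ℂ] L2 V :=
  Res B (l : ℂ)

/-- `G` is the homogeneous Cayley tree of degree `Q`: connected, acyclic,
and every vertex has exactly `Q` neighbours. -/
structure IsCayleyTree {V : Type} (G : SimpleGraph V) (Q : ℕ) : Prop where
  conn : G.Connected
  acyc : G.IsAcyclic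
  deg : ∀ v : V, (G.neighborSet v).ncard = Q

/-- `A` is the adjacency operator of the simple graph `G` on ℓ²(V). -/
def IsAdjacencyOp {V : Type} (G : SimpleGraph V) (A : L2 V →L[ℂ] L2 V) : Prop :=
  ∀ x y : V, entry A x y = if G.Adj x y then 1 else 0

/-- `P` assigns to each subset `S ⊆ V` the orthogonal projection of ℓ²(V) onto ℓ²(S). -/
def IsProjFamily {V : Type} (P : Set V → (L2 V →L[ℂ] L2 V)) : Prop :=
  ∀ (S : Set V) (f : L2 V) (x : V),
    (P S f : ∀ _ : V, ℂ) x = if x ∈ S then (f : ∀ _ : V, ℂ) x else 0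

/-- `S` is the vertex set of a connected subtree of `G` in which every vertex has
exactly `q` neighbours within `S` (a subtree of constant internal degree `q`). -/
def IsRegularSubtree {V : Type} (G : SimpleGraph V) (S : Set V) (q : ℕ) : Prop :=
  (G.induce S).Connected ∧ ∀ x ∈ S, {y : V | y ∈ S ∧ G.Adj x y}.ncard = q

/-- Distance from a vertex to a set of vertices. -/
def distToSet {V : Type} (G : SimpleGraph V) (x : V) (S : Set V) : ℕ :=
  sInf {n : ℕ | ∃ y ∈ S, G.dist x y = n}

/-- `a(λ)` of equation (4.2) of the paper, for the tree of degree `Q`. -/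
def aF (Q : ℕ) (l : ℝ) : ℝ :=
  l * (1 - Real.sqrt (1 - 4 * ((Q : ℝ) - 1) / l ^ 2)) / (2 * ((Q : ℝ) - 1))

/-- `μ(λ)` of equation (4.3) of the paper, for the tree of degree `Q`. -/
def muF (Q : ℕ) (l : ℝ) : ℝ :=
  l * (((Q : ℝ) - 2) + (Q : ℝ) * Real.sqrt (1 - 4 * ((Q : ℝ) - 1) / l ^ 2)) /
    (2 * ((Q : ℝ) - 1))

/-- `M` realizes the inverse, within the corner algebra `P·B(ℓ²)·P`, of the operator
`P − P T P` (that is, of `I_{ℓ²(S)} − S(λ)` when `T` is the resolvent and `P = P_{ℓ²(S)}`). -/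
def IsCornerInverse {V : Type} (P M T : L2 V →L[ℂ] L2 V) : Prop :=
  P ∘L M = M ∧ M ∘L P = M ∧
    M ∘L (P - P ∘L T ∘L P) = P ∧ (P - P ∘L T ∘L P) ∘L M = P

/-- The threshold `Q(q) = ⌊(2√(q−1) + 1 + √(4√(q−1) + 1))²/4⌋ + 1` of Proposition 6.2. -/
def Qbound (q : ℕ) : ℕ :=
  ⌊(2 * Real.sqrt ((q : ℝ) - 1) + 1 +
      Real.sqrt (4 * Real.sqrt ((q : ℝ) - 1) + 1)) ^ 2 / 4⌋₊ + 1


/-- In an acyclic graph the length of a path is the distance between its ends. -/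
lemma SimpleGraph.IsAcyclic.length_eq_dist_of_isPath {V : Type} {G : SimpleGraph V}
    (hG : G.IsAcyclic) {x y : V} {p : G.Walk x y} (hp : p.IsPath) : p.length = G.dist x y := by
  obtain ⟨r, hr, hrl⟩ := p.reachable.exists_path_of_dist
  have := (hG.subsingleton_path x y).elim ⟨p, hp⟩ ⟨r, hr⟩
  rw [← hrl, show p = r from congrArg Subtype.val this]

/-- A point `n` of a connected set `S` in a tree which is closest to `x` is a gate: every
geodesic from `x` to `S` passes through `n`. -/
lemma SimpleGraph.IsTree.dist_eq_add_of_closest {V : Type} {G : SimpleGraph V} (hG : G.IsTree)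
    {S : Set V} (hS : (G.induce S).Connected) {x n s : V} (hn : n ∈ S)
    (hmin : ∀ u ∈ S, G.dist x n ≤ G.dist x u) (hs : s ∈ S) :
    G.dist x s = G.dist x n + G.dist n s := by
  obtain ⟨p, hp, hpl⟩ := hG.connected.exists_path_of_dist x n
  obtain ⟨r, hr, -⟩ := hS.exists_path_of_dist ⟨n, hn⟩ ⟨s, hs⟩
  obtain ⟨r', hr'p, hr'S⟩ : ∃ r' : G.Walk n s, r'.IsPath ∧ ∀ u ∈ r'.support, u ∈ S := by
    refine ⟨r.map (Embedding.induce S).toHom, hr.map Subtype.val_injective, fun u hu => ?_⟩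
    have h := r.support_map (Embedding.induce S).toHom
    obtain ⟨w, -, rfl⟩ := List.mem_map.1 (h ▸ hu)
    exact w.2
  have hpS : ∀ u ∈ p.support, u ∈ S → u = n := by
    intro u hu huS
    have h1 := hmin u huS
    have h2 := G.dist_le (p.takeUntil u hu)
    have h3 := congrArg Walk.length (p.take_spec hu)
    rw [Walk.length_append] at h3
    exact Walk.eq_of_length_eq_zero (p := p.dropUntil u hu) (by omega)
  have hpath : (p.append r').IsPath := by
    rw [Walk.isPath_def, Walk.support_append]
    have hnd := hr'p.support_nodup
    rw [← Walk.cons_tail_support, List.nodup_cons] at hnd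
    refine List.Nodup.append hp.support_nodup hnd.2 ?_
    intro u hu hu'
    have := hpS u hu (hr'S u (List.mem_of_mem_tail hu'))
    exact hnd.1 (this ▸ hu')
  rw [← hG.isAcyclic.length_eq_dist_of_isPath hpath, Walk.length_append, hpl,
    hG.isAcyclic.length_eq_dist_of_isPath hr'p]

/-- In a tree every vertex other than `r` has exactly one neighbour closer to `r`. -/
lemma SimpleGraph.IsTree.existsUnique_adj_dist_lt {V : Type} {G : SimpleGraph V} (hG : G.IsTree)
    {x r : V} (hx : x ≠ r) : ∃! p, G.Adj x p ∧ G.dist x r = G.dist p r + 1 := by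
  obtain ⟨w, hw, hwl⟩ := hG.connected.exists_path_of_dist x r
  have key : ∀ p, G.Adj x p → G.dist x r = G.dist p r + 1 → p = w.snd := by
    intro p hxp hd
    obtain ⟨t, ht, htl⟩ := hG.connected.exists_path_of_dist p r
    have hc : (Walk.cons hxp t).IsPath := by
      apply Walk.isPath_of_length_eq_dist
      simp [htl, hd]
    have := congrArg Subtype.val ((hG.isAcyclic.subsingleton_path x r).elim ⟨_, hc⟩ ⟨w, hw⟩)
    simp only at this
    rw [← this, Walk.snd_cons]
  have hnn : ¬ w.Nil := Walk.not_nil_of_ne hx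
  refine ⟨w.snd, ⟨w.adj_snd hnn, ?_⟩, fun p hp => key p hp.1 hp.2⟩
  have h1 := G.dist_le w.tail
  have h2 := w.length_tail_add_one hnn
  have h3 : G.dist x r ≤ G.dist x w.snd + G.dist w.snd r := hG.connected.dist_triangle
  have h4 : G.dist x w.snd = 1 := dist_eq_one_iff_adj.2 (w.adj_snd hnn)
  omega

lemma distToSet_le {V : Type} {G : SimpleGraph V} {S : Set V} {x u : V} (hu : u ∈ S) :
    distToSet G x S ≤ G.dist x u :=
  Nat.sInf_le ⟨u, hu, rfl⟩

/-- `nea` is a nearest-point map onto `S`. -/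
def IsNearestMap {V : Type} (G : SimpleGraph V) (S : Set V) (nea : V → V) : Prop :=
  ∀ x : V, nea x ∈ S ∧ G.dist x (nea x) = distToSet G x S

section Nearest

open SimpleGraph

variable {V : Type} {G : SimpleGraph V} {S : Set V} {nea : V → V}

lemma IsNearestMap.dist_eq (hn : IsNearestMap G S nea) (hG : G.IsTree)
    (hS : (G.induce S).Connected) (x : V) {s : V} (hs : s ∈ S) :
    G.dist x s = distToSet G x S + G.dist (nea x) s := by
  rw [← (hn x).2]
  exact hG.dist_eq_add_of_closest hS (hn x).1
    (fun u hu => (hn x).2.trans_le (distToSet_le hu)) hs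

lemma IsNearestMap.eq_of_dist_le (hn : IsNearestMap G S nea) (hG : G.IsTree)
    (hS : (G.induce S).Connected) {x s : V} (hs : s ∈ S) (h : G.dist x s ≤ distToSet G x S) :
    nea x = s := by
  have := hn.dist_eq hG hS x hs
  exact hG.connected.dist_eq_zero_iff.1 (by omega)

lemma distToSet_of_mem {x : V} (hx : x ∈ S) : distToSet G x S = 0 := by
  have := distToSet_le (G := G) (x := x) hx
  rw [dist_self] at this
  omega

lemma IsNearestMap.apply_of_mem (hn : IsNearestMap G S nea) (hG : G.IsTree)
    (hS : (G.induce S).Connected) {x : V} (hx : x ∈ S) : nea x = x :=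
  hn.eq_of_dist_le hG hS hx (by simp)

lemma IsNearestMap.distToSet_pos (hn : IsNearestMap G S nea) (hG : G.IsTree)
    {x : V} (hx : x ∉ S) : 0 < distToSet G x S := by
  rw [← (hn x).2]
  exact hG.connected.pos_dist_of_ne fun h => hx (h ▸ (hn x).1)

/-- A neighbour of `x ∈ S` outside `S` is at distance one from `S`, with nearest point `x`. -/
lemma IsNearestMap.of_adj_mem (hn : IsNearestMap G S nea) (hG : G.IsTree)
    (hS : (G.induce S).Connected) {x y : V} (hx : x ∈ S) (hxy : G.Adj x y) (hy : y ∉ S) :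
    distToSet G y S = 1 ∧ nea y = x := by
  have h1 : G.dist y x = 1 := dist_eq_one_iff_adj.2 hxy.symm
  have h2 := distToSet_le (G := G) (x := y) hx
  have h3 := hn.distToSet_pos hG hy
  exact ⟨by omega, hn.eq_of_dist_le hG hS hx (by omega)⟩

/-- The neighbours of a vertex `x` outside `S`: one is closer to `S`, the others are farther
from `S`, and all have the same nearest point as `x`. -/
lemma IsNearestMap.exists_parent (hn : IsNearestMap G S nea) (hG : G.IsTree)
    (hS : (G.induce S).Connected) {x : V} (hx : x ∉ S) :
    ∃ p, G.Adj x p ∧ distToSet G x S = distToSet G p S + 1 ∧ nea p = nea x ∧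
      ∀ y, G.Adj x y → y ≠ p →
        y ∉ S ∧ distToSet G y S = distToSet G x S + 1 ∧ nea y = nea x := by
  have hpos := hn.distToSet_pos hG hx
  have hxd := (hn x).2
  have hxS := (hn x).1
  obtain ⟨p, ⟨hxp, hpd⟩, hpu⟩ :=
    hG.existsUnique_adj_dist_lt (x := x) (r := nea x) fun h => hx (h ▸ hxS)
  have hxp1 : G.dist x p = 1 := dist_eq_one_iff_adj.2 hxp
  have hlip : distToSet G x S ≤ distToSet G p S + 1 := by
    have h1 := distToSet_le (G := G) (x := x) (hn p).1
    have h2 : G.dist x (nea p) ≤ G.dist x p + G.dist p (nea p) := hG.connected.dist_triangle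
    have h3 := (hn p).2
    omega
  have hple := distToSet_le (G := G) (x := p) hxS
  refine ⟨p, hxp, by omega, hn.eq_of_dist_le hG hS hxS (by omega), fun y hxy hyp => ?_⟩
  have hyd : G.dist y (nea x) = G.dist x (nea x) + 1 := by
    have h1 := hG.dist_eq_dist_add_one_of_adj (nea x) hxy
    rw [G.dist_comm (u := nea x), G.dist_comm (u := nea x)] at h1
    rcases h1 with h1 | h1
    · exact absurd (hpu y ⟨hxy, h1⟩) hyp
    · exact h1
  have hgy := hn.dist_eq hG hS y hxS
  have hgx := hn.dist_eq hG hS x (hn y).1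
  have hym := (hn y).2
  have hcomm := G.dist_comm (u := nea x) (v := nea y)
  have hne : nea y = nea x := by
    by_contra hne
    have hpos' := hG.connected.pos_dist_of_ne hne
    have h1 := hG.dist_eq_dist_add_one_of_adj (nea y) hxy
    rw [G.dist_comm (u := nea y), G.dist_comm (u := nea y)] at h1
    have hyx : G.dist x (nea y) = G.dist y (nea y) + 1 := by omega
    have hpy : G.dist x (nea y) = G.dist p (nea y) + 1 := by
      have h2 : G.dist p (nea y) ≤ G.dist p (nea x) + G.dist (nea x) (nea y) :=
        hG.connected.dist_triangle
      have h3 : G.dist x (nea y) ≤ G.dist x p + G.dist p (nea y) := hG.connected.dist_triangle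
      omega
    have hxm : x ≠ nea y := fun h => hx (h ▸ (hn y).1)
    exact hyp ((hG.existsUnique_adj_dist_lt hxm).unique ⟨hxy, hyx⟩ ⟨hxp, hpy⟩)
  have hD : distToSet G y S = distToSet G x S + 1 := by
    rw [hne] at hym
    omega
  exact ⟨fun hy => by rw [distToSet_of_mem hy] at hD; omega, hD, hne⟩

/-- Within `S`, a vertex other than the root has one neighbour closer to the root, and all its
other neighbours are farther away. -/
lemma IsNearestMap.exists_parent_mem (hn : IsNearestMap G S nea) (hG : G.IsTree)
    (hS : (G.induce S).Connected) {x root : V} (hx : x ∈ S) (hroot : root ∈ S)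
    (hne : x ≠ root) :
    ∃ p ∈ S, G.Adj x p ∧ G.dist x root = G.dist p root + 1 ∧
      ∀ y, G.Adj x y → y ≠ p → G.dist y root = G.dist x root + 1 := by
  obtain ⟨p, ⟨hxp, hpd⟩, hpu⟩ := hG.existsUnique_adj_dist_lt hne
  refine ⟨p, ?_, hxp, hpd, fun y hxy hyp => ?_⟩
  · by_contra hp
    have h1 := hn.dist_eq hG hS p hroot
    rw [(hn.of_adj_mem hG hS hx hxp hp).2] at h1
    omega
  · have h1 := hG.dist_eq_dist_add_one_of_adj root hxy
    rw [G.dist_comm (u := root), G.dist_comm (u := root)] at h1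
    rcases h1 with h1 | h1
    · exact absurd (hpu y ⟨hxy, h1⟩) hyp
    · exact h1

end Nearest

lemma norm_sq_eq_tsum {V : Type} (f : L2 V) : ‖f‖ ^ 2 = ∑' x, ‖f x‖ ^ 2 := by
  have := lp.norm_rpow_eq_tsum (p := 2) (by norm_num) f
  simpa using this

lemma summable_norm_sq {V : Type} (f : L2 V) : Summable fun x => ‖f x‖ ^ 2 := by
  have := (lp.memℓp f).summable (by norm_num)
  simpa using this

/-- Weighted Schur test: a self-adjoint 0-1 kernel with finite rows and a positive
`l`-supersolution has operator norm at most `l`. -/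
lemma norm_le_of_supersolution {V : Type} (B : L2 V →L[ℂ] L2 V) (N : V → Finset V)
    (hN : ∀ x y, y ∈ N x ↔ x ∈ N y) (hB : ∀ (f : L2 V) x, B f x = ∑ y ∈ N x, f y)
    {v : V → ℝ} (hv : ∀ x, 0 < v x) {l : ℝ} (hl : 0 ≤ l)
    (hsup : ∀ x, ∑ y ∈ N x, v y ≤ l * v x) : ‖B‖ ≤ l := by
  refine ContinuousLinearMap.opNorm_le_bound _ hl fun f => ?_
  refine lp.norm_le_of_forall_sum_le (p := 2) (by norm_num) (by positivity) fun F => ?_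
  simp only [ENNReal.toReal_ofNat, Real.rpow_ofNat]
  have hrow : ∀ x, ‖B f x‖ ^ 2 ≤ ∑ y ∈ N x, l * v x * (‖f y‖ ^ 2 / v y) := by
    intro x
    have h1 : ‖B f x‖ ≤ ∑ y ∈ N x, ‖f y‖ := by
      rw [hB]
      exact norm_sum_le _ _
    have h2 : (∑ y ∈ N x, ‖f y‖) ^ 2 ≤ (∑ y ∈ N x, v y) * ∑ y ∈ N x, ‖f y‖ ^ 2 / v y := by
      refine Finset.sum_sq_le_sum_mul_sum_of_sq_le_mul _ (fun y _ => (hv y).le)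
        (fun y _ => by have := hv y; positivity) fun y _ => ?_
      rw [mul_div_cancel₀ _ (hv y).ne']
    calc ‖B f x‖ ^ 2 ≤ (∑ y ∈ N x, ‖f y‖) ^ 2 := by gcongr
      _ ≤ _ := h2
      _ ≤ (l * v x) * ∑ y ∈ N x, ‖f y‖ ^ 2 / v y := by
          refine mul_le_mul_of_nonneg_right (hsup x) (Finset.sum_nonneg fun y _ => ?_)
          have := hv y
          positivity
      _ = _ := Finset.mul_sum _ _ _
  calc ∑ x ∈ F, ‖B f x‖ ^ 2 ≤ ∑ x ∈ F, ∑ y ∈ N x, l * v x * (‖f y‖ ^ 2 / v y) :=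
        Finset.sum_le_sum fun x _ => hrow x
    _ = ∑ y ∈ F.biUnion N, ∑ x ∈ F with x ∈ N y, l * v x * (‖f y‖ ^ 2 / v y) := by
        refine Finset.sum_comm' fun x y => ?_
        simp only [Finset.mem_biUnion, Finset.mem_filter, hN x y]
        exact ⟨fun h => ⟨⟨h.1, h.2⟩, x, h.1, (hN x y).2 h.2⟩, fun h => h.1⟩
    _ ≤ ∑ y ∈ F.biUnion N, l ^ 2 * ‖f y‖ ^ 2 := by
        refine Finset.sum_le_sum fun y _ => ?_
        have hy := hv y
        rw [← Finset.sum_mul, ← Finset.mul_sum]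
        have h1 : ∑ x ∈ F with x ∈ N y, v x ≤ l * v y :=
          (Finset.sum_le_sum_of_subset_of_nonneg (fun x hx => (Finset.mem_filter.1 hx).2)
            fun x _ _ => (hv x).le).trans (hsup y)
        calc l * (∑ x ∈ F with x ∈ N y, v x) * (‖f y‖ ^ 2 / v y)
            ≤ l * (l * v y) * (‖f y‖ ^ 2 / v y) := by gcongr
          _ = _ := by field_simp
    _ ≤ ∑' y, l ^ 2 * ‖f y‖ ^ 2 :=
        ((summable_norm_sq f).mul_left _).sum_le_tsum _ fun y _ => by positivity
    _ = (l * ‖f‖) ^ 2 := by rw [tsum_mul_left, ← norm_sq_eq_tsum, mul_pow]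

/-- Above the norm of an operator with nonnegative 0-1 kernel there are nonnegative
supersolutions, given by the Neumann series of the resolvent. -/
lemma exists_supersolution {V : Type} (B : L2 V →L[ℂ] L2 V) (N : V → Finset V)
    (hB : ∀ (f : L2 V) x, B f x = ∑ y ∈ N x, f y) {l : ℝ} (hl : ‖B‖ < l) (o : V) :
    ∃ h : V → ℝ, (∀ x, 0 ≤ h x) ∧ 0 < h o ∧ ∀ x, ∑ y ∈ N x, h y ≤ l * h x := by
  have hl0 : 0 < l := (norm_nonneg B).trans_lt hl
  set T : L2 V →L[ℂ] L2 V := ((l⁻¹ : ℝ) : ℂ) • B with hT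
  have hT1 : ‖T‖ < 1 := by
    rw [hT, norm_smul, Complex.norm_real, Real.norm_of_nonneg (by positivity),
      inv_mul_lt_iff₀ hl0, mul_one]
    exact hl
  have hTf : ∀ (f : L2 V) x, T f x = ((l⁻¹ : ℝ) : ℂ) * ∑ y ∈ N x, f y := by
    intro f x
    rw [← hB]
    rfl
  set u : L2 V := (∑' n : ℕ, T ^ n) (delta o) with hu
  have hsum : Summable fun n : ℕ => T ^ n := summable_geometric_of_norm_lt_one hT1
  have hfix : u - T u = delta o := by
    have := congrArg (fun R : L2 V →L[ℂ] L2 V => R (delta o)) (mul_neg_geom_series T hT1)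
    simpa using this
  have hpow : ∀ (n : ℕ) x, 0 ≤ ((T ^ n) (delta o) x).re := by
    intro n
    induction n with
    | zero =>
      intro x
      simp only [pow_zero, one_apply_eq_self, delta]
      rw [lp.single_apply]
      by_cases h : x = o
      · subst h; simp
      · simp [h]
    | succ n ih =>
      intro x
      rw [pow_succ', mul_apply_eq_comp, hTf, Complex.re_ofReal_mul, Complex.re_sum]
      exact mul_nonneg (by positivity) (Finset.sum_nonneg fun y _ => ih y)
  have hnonneg : ∀ x, 0 ≤ (u x).re := by
    intro x
    let ev : (L2 V →L[ℂ] L2 V) → ℝ := fun R => (R (delta o) x).re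
    have hcont : Continuous ev := by
      refine Complex.continuous_re.comp ?_
      have h1 : Continuous fun f : L2 V => f x := (lp.lipschitzWith_one_eval 2 x).continuous
      exact h1.comp (by fun_prop : Continuous fun R : L2 V →L[ℂ] L2 V => R (delta o))
    have hlim := (hcont.tendsto _).comp hsum.hasSum.tendsto_sum_nat
    refine ge_of_tendsto' hlim fun n => ?_
    simp only [ev, Function.comp]
    rw [_root_.sum_apply, lp.coeFn_sum, Finset.sum_apply, Complex.re_sum]
    exact Finset.sum_nonneg fun k _ => hpow k x
  have hcoord : ∀ x, l * (u x).re = ∑ y ∈ N x, (u y).re + l * (delta o x).re := by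
    intro x
    have h1 : u x - T u x = delta o x := by
      rw [← hfix]; rfl
    rw [← h1, hTf, Complex.sub_re, Complex.re_ofReal_mul, Complex.re_sum]
    field_simp
    ring
  have hδ : ∀ x, (delta o x).re = if x = o then 1 else 0 := by
    intro x
    simp only [delta]
    rw [lp.single_apply]
    by_cases h : x = o
    · subst h; simp
    · simp [h]
  refine ⟨fun x => (u x).re, hnonneg, ?_, fun x => ?_⟩
  · have h1 := hcoord o
    rw [hδ, if_pos rfl] at h1
    have h2 : 0 ≤ ∑ y ∈ N o, (u y).re := Finset.sum_nonneg fun y _ => hnonneg y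
    have h3 : 0 < l * (u o).re := by linarith
    exact pos_of_mul_pos_right h3 hl0.le
  · rw [hcoord x, hδ]
    have : 0 ≤ l * (if x = o then (1 : ℝ) else 0) := by split_ifs <;> simp [hl0.le]
    linarith

/-- If along every edge `(p, c)` of a nonempty family, lower bounds `r` for the ratios `h c / h p`
propagate through `h p + m r h c ≤ k h c`, then the quadratic `m r² - k r + 1` takes a nonpositive
value at some lower bound `r`. -/
lemma exists_ratio_bound {V : Type} {E : V → V → Prop} {h : V → ℝ} (hpos : ∀ x, 0 < h x)
    {m k : ℝ} (hE : ∃ p c, E p c)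
    (hrec : ∀ r : ℝ, 0 ≤ r → (∀ p c, E p c → r * h p ≤ h c) →
      ∀ p c, E p c → h p + m * (r * h c) ≤ k * h c) :
    ∃ r : ℝ, 0 ≤ r ∧ (∀ p c, E p c → r * h p ≤ h c) ∧ m * r ^ 2 - k * r + 1 ≤ 0 := by
  set R : Set ℝ := {r | 0 ≤ r ∧ ∀ p c, E p c → r * h p ≤ h c} with hR
  obtain ⟨p₀, c₀, h₀⟩ := hE
  have h0R : (0 : ℝ) ∈ R := ⟨le_rfl, fun p c _ => by rw [zero_mul]; exact (hpos c).le⟩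
  have hbdd : BddAbove R :=
    ⟨h c₀ / h p₀, fun r hr => (le_div_iff₀ (hpos p₀)).2 (hr.2 _ _ h₀)⟩
  have hs0 : 0 ≤ sSup R := le_csSup hbdd h0R
  have hsR : ∀ p c, E p c → sSup R * h p ≤ h c := fun p c hpc =>
    (le_div_iff₀ (hpos p)).1
      (csSup_le ⟨0, h0R⟩ fun r hr => (le_div_iff₀ (hpos p)).2 (hr.2 _ _ hpc))
  have hstep := hrec _ hs0 hsR
  have hd : 0 < k - m * sSup R := by
    have := hstep _ _ h₀
    have hp := hpos p₀
    have hc := hpos c₀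
    by_contra hcon
    nlinarith
  have hinv : 1 / (k - m * sSup R) ∈ R := by
    refine ⟨by positivity, fun p c hpc => ?_⟩
    have := hstep _ _ hpc
    rw [one_div, inv_mul_le_iff₀ hd]
    linarith
  have hle := le_csSup hbdd hinv
  rw [div_le_iff₀ hd] at hle
  exact ⟨sSup R, hs0, hsR, by nlinarith⟩

lemma IsAdjacencyOp.apply_eq_sum {V : Type} {G : SimpleGraph V} {A : L2 V →L[ℂ] L2 V}
    (hA : IsAdjacencyOp G A) (hsa : IsSelfAdjoint A) (f : L2 V) (x : V)
    (hfin : (G.neighborSet x).Finite) : A f x = ∑ y ∈ hfin.toFinset, f y := by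
  have h1 : inner ℂ (delta x) (A f) = A f x := by
    have := lp.inner_single_left (𝕜 := ℂ) (G := fun _ : V => ℂ) x (1 : ℂ) (A f)
    simpa [delta] using this
  have h2 : inner ℂ (delta x) (A f) = inner ℂ (A (delta x)) f := by
    rw [← ContinuousLinearMap.adjoint_inner_left, ← ContinuousLinearMap.star_eq_adjoint,
      hsa.star_eq]
  rw [← h1, h2, lp.inner_eq_tsum]
  have h3 : ∀ y, A (delta x) y = if G.Adj y x then 1 else 0 := fun y => hA y x
  rw [tsum_eq_sum (s := hfin.toFinset)]
  · refine Finset.sum_congr rfl fun y hy => ?_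
    rw [Finite.mem_toFinset, SimpleGraph.mem_neighborSet] at hy
    rw [h3, if_pos hy.symm]
    simp
  · intro y hy
    rw [Finite.mem_toFinset, SimpleGraph.mem_neighborSet] at hy
    rw [h3, if_neg fun h => hy h.symm]
    simp

section Scalars

lemma aF_spec {Q : ℕ} (hQ : 1 < Q) {l : ℝ} (hl : 2 * √((Q : ℝ) - 1) < l) :
    0 < aF Q l ∧ ((Q : ℝ) - 1) * aF Q l ^ 2 + 1 = l * aF Q l ∧
      ((Q : ℝ) - 1) * aF Q l ^ 2 < 1 ∧ muF Q l = l - Q * aF Q l := by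
  have hQ' : (1 : ℝ) < Q := by exact_mod_cast hQ
  have hm : 0 < (Q : ℝ) - 1 := by linarith
  have hl0 : 0 < l := lt_of_le_of_lt (by positivity) hl
  have hl2 : 4 * ((Q : ℝ) - 1) < l ^ 2 := by
    have h := Real.sq_sqrt hm.le
    have h' := Real.sqrt_nonneg ((Q : ℝ) - 1)
    nlinarith
  simp only [aF, muF]
  set s := √(1 - 4 * ((Q : ℝ) - 1) / l ^ 2) with hs
  have hd : 4 * ((Q : ℝ) - 1) / l ^ 2 < 1 := (div_lt_one (by positivity)).2 hl2
  have hd0 : 0 < 4 * ((Q : ℝ) - 1) / l ^ 2 := by positivity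
  have hs0 : 0 < s := Real.sqrt_pos.2 (by linarith)
  have hs2 : s ^ 2 = 1 - 4 * ((Q : ℝ) - 1) / l ^ 2 := Real.sq_sqrt (by linarith)
  have hs1 : s < 1 := by nlinarith
  have hls : l ^ 2 * (1 - s ^ 2) = 4 * ((Q : ℝ) - 1) := by
    rw [hs2]
    field_simp
    ring
  set a := l * (1 - s) / (2 * ((Q : ℝ) - 1)) with ha
  have h2 : 2 * ((Q : ℝ) - 1) * a = l * (1 - s) := by
    rw [ha]
    field_simp
  have ha0 : 0 < a := div_pos (mul_pos hl0 (by linarith)) (by linarith)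
  have hquad : ((Q : ℝ) - 1) * a ^ 2 + 1 = l * a := by
    have h3 : ((Q : ℝ) - 1) * (((Q : ℝ) - 1) * a ^ 2 + 1 - l * a) = 0 := by
      linear_combination (1 / 4) * hls * (-1) + (1 / 4) * (2 * ((Q : ℝ) - 1) * a + l * (1 - s)) * h2
        - (l / 2) * h2
    rcases mul_eq_zero.1 h3 with h | h <;> linarith
  refine ⟨ha0, hquad, ?_, ?_⟩
  · have : 2 * ((Q : ℝ) - 1) * a < l := by
      rw [h2]
      nlinarith
    nlinarith
  · rw [div_eq_iff (by positivity)]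
    linear_combination (Q : ℝ) * h2

/-- The secular equation in polynomial form. -/
lemma secular_eq {Q q : ℕ} (hq : 2 < q) (hQq : q ≤ Q) {l : ℝ} (hl : 2 * √((Q : ℝ) - 1) < l)
    (hsec : (1 - aF Q l ^ 2) / (1 - aF Q l * √((q : ℝ) - 1)) ^ 2 = muF Q l) :
    l = 2 * √((q : ℝ) - 1) + 1 + ((Q : ℝ) - q) * aF Q l := by
  obtain ⟨ha, hquad, hlt, hmu⟩ := aF_spec (by omega : 1 < Q) hl
  set a := aF Q l
  set t := √((q : ℝ) - 1) with ht
  have hq' : (2 : ℝ) < q := by exact_mod_cast hq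
  have hQ' : (q : ℝ) ≤ Q := by exact_mod_cast hQq
  have ht2 : t ^ 2 = (q : ℝ) - 1 := Real.sq_sqrt (by linarith)
  have hat : (a * t) ^ 2 < 1 := by
    rw [mul_pow, ht2]
    nlinarith [sq_nonneg a]
  have hat1 : 0 < 1 - a * t := by nlinarith
  have ha1 : a ^ 2 < 1 := by nlinarith [sq_nonneg a]
  rw [hmu, div_eq_iff (by positivity)] at hsec
  have h1 : (1 - a ^ 2) * (a - (1 - a * t) ^ 2) = 0 := by
    linear_combination a * hsec - (1 - a * t) ^ 2 * hquad
  have h2 : a = (1 - a * t) ^ 2 := by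
    rcases mul_eq_zero.1 h1 with h | h <;> linarith
  have h3 : a * (l - (2 * t + 1 + ((Q : ℝ) - q) * a)) = 0 := by
    linear_combination -hquad - h2 - a ^ 2 * ht2
  rcases mul_eq_zero.1 h3 with h | h <;> linarith

end Scalars

/-- The closed neighbourhoods of the kernel `A + P_S`: a loop is added at each vertex of `S`. -/
def loopNbhd {V : Type} (nb : V → Finset V) (S : Set V) (x : V) : Finset V :=
  if x ∈ S then insert x (nb x) else nb x

section Tree

open SimpleGraph

variable {V : Type} {G : SimpleGraph V} {S : Set V} {nea : V → V} {nb : V → Finset V}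
  {q Q : ℕ} {root : V}

lemma sum_loopNbhd {M : Type} [AddCommMonoid M] (hnb : ∀ x y, y ∈ nb x ↔ G.Adj x y)
    (f : V → M) (x : V) :
    ∑ y ∈ loopNbhd nb S x, f y = ∑ y ∈ nb x, f y + if x ∈ S then f x else 0 := by
  unfold loopNbhd
  split_ifs
  · rw [Finset.sum_insert (by rw [hnb]; exact G.irrefl), add_comm]
  · rw [add_zero]

lemma mem_loopNbhd_comm (hnb : ∀ x y, y ∈ nb x ↔ G.Adj x y) (x y : V) :
    y ∈ loopNbhd nb S x ↔ x ∈ loopNbhd nb S y := by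
  have h : ∀ x y, y ∈ loopNbhd nb S x ↔ G.Adj x y ∨ (x ∈ S ∧ y = x) := by
    intro x y
    unfold loopNbhd
    split_ifs with hx
    · simp [hnb, hx, or_comm]
    · simp [hnb, hx]
  rw [h, h, G.adj_comm]
  constructor <;> rintro (h | ⟨h, rfl⟩) <;> simp_all

/-- The neighbour sum on `S` splits into neighbours in `S` and neighbours outside `S`. -/
lemma card_filter_notMem (hcard : ∀ x, (nb x).card = Q)
    (hcardS : ∀ x ∈ S, ((nb x).filter (· ∈ S)).card = q) {x : V} (hx : x ∈ S) :
    (((nb x).filter (· ∉ S)).card : ℝ) = (Q : ℝ) - q := by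
  have h1 := Finset.card_filter_add_card_filter_not (s := nb x) (· ∈ S)
  rw [hcardS x hx, hcard] at h1
  rw [← h1]
  push_cast
  ring

/-- The function `φ_{1/2}` satisfies `A_S φ = 2√(q-1) φ` on the `q`-regular tree `S`. -/
lemma sum_filter_phi (hn : IsNearestMap G S nea) (hG : G.IsTree) (hS : (G.induce S).Connected)
    (hnb : ∀ x y, y ∈ nb x ↔ G.Adj x y)
    (hcardS : ∀ x ∈ S, ((nb x).filter (· ∈ S)).card = q) (hroot : root ∈ S) (hq : 2 < q)
    {t : ℝ} (ht : 0 < t) (ht2 : t ^ 2 = (q : ℝ) - 1) {phi : V → ℝ}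
    (hphi : ∀ y, phi y = (1 + ((q : ℝ) - 2) / (q : ℝ) * (G.dist y root : ℝ)) *
        t ^ (-(G.dist y root : ℤ))) {x : V} (hx : x ∈ S) :
    ∑ y ∈ (nb x).filter (· ∈ S), phi y = 2 * t * phi x := by
  have hq' : (2 : ℝ) < q := by exact_mod_cast hq
  have hq0 : (q : ℝ) ≠ 0 := by positivity
  by_cases hxr : x = root
  · subst hxr
    have h1 : ∀ y ∈ (nb x).filter (· ∈ S), phi y = (1 + ((q : ℝ) - 2) / q) * t⁻¹ := by
      intro y hy
      rw [Finset.mem_filter, hnb] at hy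
      rw [hphi, dist_eq_one_iff_adj.2 hy.1.symm]
      simp
    rw [Finset.sum_congr rfl h1, Finset.sum_const, hcardS x hx, hphi, dist_self, nsmul_eq_mul]
    simp only [Nat.cast_zero, mul_zero, add_zero, neg_zero, zpow_zero, mul_one]
    field_simp
    rw [ht2]
    ring
  · obtain ⟨p, hpS, hxp, hpd, hy⟩ := hn.exists_parent_mem hG hS hx hroot hxr
    have hpm : p ∈ (nb x).filter (· ∈ S) := Finset.mem_filter.2 ⟨(hnb x p).2 hxp, hpS⟩
    rw [← Finset.add_sum_erase _ _ hpm]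
    set n := G.dist p root with hn'
    have h1 : ∀ y ∈ ((nb x).filter (· ∈ S)).erase p,
        phi y = (1 + ((q : ℝ) - 2) / q * ((n : ℝ) + 2)) * (t ^ (n + 2))⁻¹ := by
      intro y hym
      rw [Finset.mem_erase, Finset.mem_filter, hnb] at hym
      rw [hphi, hy y hym.2.1 hym.1, hpd, zpow_neg, zpow_natCast]
      push_cast
      ring_nf
    rw [Finset.sum_congr rfl h1, Finset.sum_const, Finset.card_erase_of_mem hpm, hcardS x hx,
      hphi p, hphi x, hpd, ← hn', nsmul_eq_mul, Nat.cast_sub (by omega), zpow_neg, zpow_neg,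
      zpow_natCast, zpow_natCast]
    push_cast
    rw [← ht2, pow_add, pow_succ t n]
    field_simp
    ring

/-- The weight `a^{d(x,S)} φ(y(x))` is an eigenfunction of `A + P_S`. -/
lemma sum_loopNbhd_weight (hn : IsNearestMap G S nea) (hG : G.IsTree)
    (hS : (G.induce S).Connected) (hnb : ∀ x y, y ∈ nb x ↔ G.Adj x y)
    (hcard : ∀ x, (nb x).card = Q) (hcardS : ∀ x ∈ S, ((nb x).filter (· ∈ S)).card = q)
    {a l t : ℝ} (hquad : ((Q : ℝ) - 1) * a ^ 2 + 1 = l * a)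
    (hl : l = 2 * t + 1 + ((Q : ℝ) - q) * a) {phi v : V → ℝ}
    (hphi : ∀ x ∈ S, ∑ y ∈ (nb x).filter (· ∈ S), phi y = 2 * t * phi x)
    (hv : ∀ x, v x = a ^ distToSet G x S * phi (nea x)) (x : V) :
    ∑ y ∈ loopNbhd nb S x, v y = l * v x := by
  rw [sum_loopNbhd hnb]
  by_cases hx : x ∈ S
  · have hvS : ∀ y ∈ S, v y = phi y := by
      intro y hy
      rw [hv, distToSet_of_mem hy, hn.apply_of_mem hG hS hy, pow_zero, one_mul]
    have h2 : ∑ y ∈ (nb x).filter (· ∉ S), v y = ((Q : ℝ) - q) * (a * phi x) := by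
      rw [← card_filter_notMem hcard hcardS hx, ← nsmul_eq_mul, ← Finset.sum_const]
      refine Finset.sum_congr rfl fun y hy => ?_
      rw [Finset.mem_filter, hnb] at hy
      obtain ⟨hd, hne⟩ := hn.of_adj_mem hG hS hx hy.1 hy.2
      rw [hv, hd, hne, pow_one]
    rw [if_pos hx, ← Finset.sum_filter_add_sum_filter_not (nb x) (· ∈ S), h2,
      Finset.sum_congr rfl fun y hy => hvS y (Finset.mem_filter.1 hy).2, hphi x hx, hvS x hx, hl]
    ring
  · obtain ⟨p, hxp, hpd, hpn, hy⟩ := hn.exists_parent hG hS hx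
    have hpm : p ∈ nb x := (hnb x p).2 hxp
    have h1 : ∀ y ∈ (nb x).erase p, v y = a ^ (distToSet G p S + 2) * phi (nea x) := by
      intro y hym
      rw [Finset.mem_erase, hnb] at hym
      obtain ⟨-, hd, hne⟩ := hy y hym.2 hym.1
      rw [hv, hd, hne, hpd]
    have hQ1 : 1 ≤ Q := by
      rw [← hcard x]
      exact Finset.card_pos.2 ⟨p, hpm⟩
    rw [if_neg hx, add_zero, ← Finset.add_sum_erase _ _ hpm, Finset.sum_congr rfl h1,
      Finset.sum_const, Finset.card_erase_of_mem hpm, hcard, hv p, hv x, hpn, hpd, nsmul_eq_mul,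
      Nat.cast_sub hQ1]
    push_cast
    linear_combination a ^ distToSet G p S * phi (nea x) * hquad

/-- A positive `l'`-supersolution retains at least a fraction `a` of its value on each step out
of `S`, where
`a` is the smaller root of `(Q-1)a² - la + 1` and `l' ≤ l`. -/
lemma mul_le_of_supersolution (hn : IsNearestMap G S nea) (hG : G.IsTree)
    (hS : (G.induce S).Connected) (hnb : ∀ x y, y ∈ nb x ↔ G.Adj x y)
    (hcard : ∀ x, (nb x).card = Q) {a l l' : ℝ} (ha : 0 < a)
    (hquad : ((Q : ℝ) - 1) * a ^ 2 + 1 = l * a) (hlt : ((Q : ℝ) - 1) * a ^ 2 < 1)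
    (hQ : 1 < Q) (hll : l' ≤ l) {h : V → ℝ} (hpos : ∀ x, 0 < h x)
    (hsup : ∀ x, ∑ y ∈ loopNbhd nb S x, h y ≤ l' * h x) {x y : V} (hx : x ∈ S)
    (hxy : G.Adj x y) (hy : y ∉ S) : a * h x ≤ h y := by
  let E : V → V → Prop := fun p c =>
    c ∉ S ∧ G.Adj c p ∧ distToSet G c S = distToSet G p S + 1
  have hE : E x y := ⟨hy, hxy.symm, by
    rw [distToSet_of_mem hx, (hn.of_adj_mem hG hS hx hxy hy).1]⟩
  have hQ' : (1 : ℝ) < Q := by exact_mod_cast hQ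
  obtain ⟨r, hr0, hr, hrq⟩ :=
      exists_ratio_bound (E := E) hpos (m := (Q : ℝ) - 1) (k := l') ⟨x, y, hE⟩ (by
    rintro r hr0 hr p c ⟨hc, hcp, hd⟩
    obtain ⟨p', hcp', hpd', -, hch⟩ := hn.exists_parent hG hS hc
    have hpp : p = p' := by
      by_contra hne
      have := (hch p hcp hne).2.1
      omega
    subst hpp
    have hpm : p ∈ nb c := (hnb c p).2 hcp
    refine le_trans ?_ (hsup c)
    rw [sum_loopNbhd hnb, if_neg hc, add_zero, ← Finset.add_sum_erase _ _ hpm]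
    have h1 : ((nb c).erase p).card • (r * h c) ≤ ∑ z ∈ (nb c).erase p, h z := by
      refine Finset.card_nsmul_le_sum _ _ _ fun z hz => ?_
      rw [Finset.mem_erase, hnb] at hz
      obtain ⟨hzS, hzd, -⟩ := hch z hz.2 hz.1
      exact hr c z ⟨hzS, hz.2.symm, hzd⟩
    rw [Finset.card_erase_of_mem hpm, hcard, nsmul_eq_mul, Nat.cast_sub hQ.le,
      Nat.cast_one] at h1
    linarith)
  have har : a ≤ r := by
    by_contra! hra
    have h2 : 2 * ((Q : ℝ) - 1) * a < l := by
      by_contra! hcon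
      nlinarith
    have h3 : ((Q : ℝ) - 1) * (r + a) < l := by nlinarith
    nlinarith [mul_pos (sub_pos.2 hra) (sub_pos.2 h3)]
  exact (mul_le_mul_of_nonneg_right har (hpos x).le).trans (hr _ _ hE)

/-- There is no positive `l'`-supersolution of `A + P_S` for `l' < l`. -/
lemma le_norm_of_secular (hn : IsNearestMap G S nea) (hG : G.IsTree)
    (hS : (G.induce S).Connected) (hnb : ∀ x y, y ∈ nb x ↔ G.Adj x y)
    (hcard : ∀ x, (nb x).card = Q) (hcardS : ∀ x ∈ S, ((nb x).filter (· ∈ S)).card = q)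
    (hroot : root ∈ S) (hq : 2 < q) (hQ : 1 < Q) {a l t : ℝ} (ha : 0 < a)
    (hquad : ((Q : ℝ) - 1) * a ^ 2 + 1 = l * a) (hlt : ((Q : ℝ) - 1) * a ^ 2 < 1)
    (ht2 : t ^ 2 = (q : ℝ) - 1) (hl : l = 2 * t + 1 + ((Q : ℝ) - q) * a)
    (B : L2 V →L[ℂ] L2 V) (hB : ∀ (f : L2 V) x, B f x = ∑ y ∈ loopNbhd nb S x, f y) :
    l ≤ ‖B‖ := by
  by_contra! hBl
  obtain ⟨l', hBl', hll⟩ := exists_between hBl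
  obtain ⟨h, hnonneg, hroot0, hsup⟩ := exists_supersolution B _ hB hBl' root
  have hl0 : 0 < l' := (norm_nonneg B).trans_lt hBl'
  have hadj : ∀ x y, G.Adj x y → 0 < h y → 0 < h x := by
    intro x y hxy hy
    have h1 : h y ≤ ∑ z ∈ nb x, h z :=
      Finset.single_le_sum (fun z _ => hnonneg z) ((hnb x y).2 hxy)
    have h2 := hsup x
    rw [sum_loopNbhd hnb] at h2
    have h3 : 0 ≤ if x ∈ S then h x else 0 := by split_ifs <;> simp [hnonneg]
    exact pos_of_mul_pos_right (by linarith : 0 < l' * h x) hl0.le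
  have hpos : ∀ x, 0 < h x := by
    intro x
    obtain ⟨w⟩ := hG.connected.preconnected x root
    induction w with
    | nil => exact hroot0
    | cons hab _ ih => exact hadj _ _ hab (ih hroot hroot0)
  have hout : ∀ {x y}, x ∈ S → G.Adj x y → y ∉ S → a * h x ≤ h y :=
    mul_le_of_supersolution hn hG hS hnb hcard ha hquad hlt hQ hll.le hpos hsup
  have hinner : ∀ x ∈ S, ∑ y ∈ (nb x).filter (· ∈ S), h y ≤
      (l' - 1 - ((Q : ℝ) - q) * a) * h x := by
    intro x hx
    have h1 := hsup x
    rw [sum_loopNbhd hnb, if_pos hx, ← Finset.sum_filter_add_sum_filter_not (nb x) (· ∈ S)] at h1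
    have h2 : ((nb x).filter (· ∉ S)).card • (a * h x) ≤ ∑ y ∈ (nb x).filter (· ∉ S), h y := by
      refine Finset.card_nsmul_le_sum _ _ _ fun z hz => ?_
      rw [Finset.mem_filter, hnb] at hz
      exact hout hx hz.1 hz.2
    rw [nsmul_eq_mul, card_filter_notMem hcard hcardS hx] at h2
    linarith
  let E : V → V → Prop := fun p c =>
    p ∈ S ∧ c ∈ S ∧ G.Adj c p ∧ G.dist c root = G.dist p root + 1
  obtain ⟨c₀, hc₀⟩ : ((nb root).filter (· ∈ S)).Nonempty :=
    Finset.card_pos.1 (by rw [hcardS root hroot]; omega)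
  rw [Finset.mem_filter, hnb] at hc₀
  have hE : E root c₀ :=
    ⟨hroot, hc₀.2, hc₀.1.symm, by rw [dist_self, dist_eq_one_iff_adj.2 hc₀.1.symm]⟩
  obtain ⟨r, hr0, -, hrq⟩ := exists_ratio_bound (E := E) hpos (m := (q : ℝ) - 1)
      (k := l' - 1 - ((Q : ℝ) - q) * a) ⟨_, _, hE⟩ (by
    rintro r hr0 hr p c ⟨hpS, hcS, hcp, hd⟩
    have hcr : c ≠ root := by
      rintro rfl
      rw [dist_self] at hd
      omega
    obtain ⟨p', -, hcp', hpd', hch⟩ := hn.exists_parent_mem hG hS hcS hroot hcr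
    have hpp : p = p' := by
      by_contra hne
      have := hch p hcp hne
      omega
    subst hpp
    have hpm : p ∈ (nb c).filter (· ∈ S) := Finset.mem_filter.2 ⟨(hnb c p).2 hcp, hpS⟩
    refine le_trans ?_ (hinner c hcS)
    rw [← Finset.add_sum_erase _ _ hpm]
    have h1 : (((nb c).filter (· ∈ S)).erase p).card • (r * h c) ≤
        ∑ z ∈ ((nb c).filter (· ∈ S)).erase p, h z := by
      refine Finset.card_nsmul_le_sum _ _ _ fun z hz => ?_
      rw [Finset.mem_erase, Finset.mem_filter, hnb] at hz
      exact hr c z ⟨hcS, hz.2.2, hz.2.1.symm, hch z hz.2.1 hz.1⟩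
    rw [Finset.card_erase_of_mem hpm, hcardS c hcS, nsmul_eq_mul, Nat.cast_sub (by omega),
      Nat.cast_one] at h1
    linarith)
  have hr1 : 0 < r := by
    rcases hr0.eq_or_lt with h | h
    · rw [← h] at hrq
      norm_num at hrq
    · exact h
  rw [← ht2] at hrq
  nlinarith [sq_nonneg (t * r - 1), mul_pos hr1 (sub_pos.2 hll)]

end Tree

/-- **Theorem 6.3.** For `2 < q ≤ Q ≤ Q(q)`, let `λ* > 2√(Q−1)` be the solution of the
secular equation `(1 − a(λ)²)/(1 − a(λ)√(q−1))² = μ(λ)`; then `λ* = ‖A_{𝔾^{Q,q}}‖`, and the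
weight `v(x) = a(λ*)^{d(x,S)}·φ_{1/2}(y(x))`, where `y(x)` is the vertex of `S` nearest to
`x` and `φ_{1/2}(y) = (1 + ((q−2)/q)d(y,0))(q−1)^{−d(y,0)/2}`, is a generalized
Perron–Frobenius eigenvector of `A_{𝔾^{Q,q}} = A + P_{ℓ²(S)}`. -/
theorem perron_frobenius_GQq (q Q : ℕ) (hq : 2 < q) (hQq : q ≤ Q) (hQb : Q ≤ Qbound q)
    {V : Type} (G : SimpleGraph V) (hG : IsCayleyTree G Q)
    (A : L2 V →L[ℂ] L2 V) (hA : IsAdjacencyOp G A) (hsa : IsSelfAdjoint A)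
    (P : Set V → (L2 V →L[ℂ] L2 V)) (hP : IsProjFamily P)
    (S : Set V) (hS : IsRegularSubtree G S q)
    (root : V) (hroot : root ∈ S)
    (lamstar : ℝ) (hl : 2 * Real.sqrt ((Q : ℝ) - 1) < lamstar)
    (hsec : (1 - aF Q lamstar ^ 2) /
        (1 - aF Q lamstar * Real.sqrt ((q : ℝ) - 1)) ^ 2 = muF Q lamstar)
    (nea : V → V) (hnea : ∀ x : V, nea x ∈ S ∧ G.dist x (nea x) = distToSet G x S)
    (phi : V → ℝ)
    (hphi : ∀ y : V, phi y =
      (1 + ((q : ℝ) - 2) / (q : ℝ) * (G.dist y root : ℝ)) *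
        Real.sqrt ((q : ℝ) - 1) ^ (-(G.dist y root : ℤ)))
    (v : V → ℝ)
    (hv : ∀ x : V, v x = aF Q lamstar ^ distToSet G x S * phi (nea x)) :
    lamstar = ‖A + P S‖ ∧
    (∀ x : V, 0 < v x) ∧
    (∀ x : V, (∑' y : G.neighborSet x, v (y : V)) + S.indicator v x = lamstar * v x) := by
  have hnear : IsNearestMap G S nea := hnea
  have hT : G.IsTree := ⟨hG.conn, hG.acyc⟩
  have hfin : ∀ x, (G.neighborSet x).Finite := fun x =>
    Set.finite_of_ncard_ne_zero (by rw [hG.deg]; omega)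
  set nb : V → Finset V := fun x => (hfin x).toFinset with hnb_def
  have hnb : ∀ x y, y ∈ nb x ↔ G.Adj x y := fun x y => by simp [hnb_def]
  have hcard : ∀ x, (nb x).card = Q := fun x => by
    rw [← hG.deg x, Set.ncard_eq_toFinset_card _ (hfin x)]
  have hcardS : ∀ x ∈ S, ((nb x).filter (· ∈ S)).card = q := fun x hx => by
    rw [← hS.2 x hx, ← Set.ncard_coe_finset]
    congr 1
    ext y
    simp [hnb, and_comm]
  obtain ⟨ha, hquad, hlt, -⟩ := aF_spec (by omega : 1 < Q) hl
  have hlam := secular_eq hq hQq hl hsec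
  have hq' : (2 : ℝ) < q := by exact_mod_cast hq
  have ht : 0 < √((q : ℝ) - 1) := Real.sqrt_pos.2 (by linarith)
  have ht2 : √((q : ℝ) - 1) ^ 2 = (q : ℝ) - 1 := Real.sq_sqrt (by linarith)
  have hB : ∀ (f : L2 V) x, (A + P S) f x = ∑ y ∈ loopNbhd nb S x, f y := by
    intro f x
    rw [sum_loopNbhd hnb, ← hA.apply_eq_sum hsa f x (hfin x), ← hP S f x]
    rfl
  have hvpos : ∀ x, 0 < v x := by
    intro x
    rw [hv, hphi]
    have : 0 ≤ ((q : ℝ) - 2) / q := div_nonneg (by linarith) (by linarith)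
    positivity
  have heig : ∀ x, ∑ y ∈ loopNbhd nb S x, v y = lamstar * v x :=
    sum_loopNbhd_weight hnear hT hS.1 hnb hcard hcardS hquad hlam
      (fun x hx => sum_filter_phi hnear hT hS.1 hnb hcardS hroot hq ht ht2 hphi hx) hv
  have hl0 : 0 ≤ lamstar := le_trans (by positivity) hl.le
  refine ⟨le_antisymm ?_ ?_, hvpos, fun x => ?_⟩
  · exact le_norm_of_secular hnear hT hS.1 hnb hcard hcardS hroot hq (by omega) ha hquad hlt ht2
      hlam _ hB
  · exact norm_le_of_supersolution _ _ (mem_loopNbhd_comm hnb) hB hvpos hl0 fun x => (heig x).le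
  · rw [← heig x, sum_loopNbhd hnb, Set.indicator_apply]
    congr 1
    have := Finset.tsum_subtype' (nb x) v
    rwa [Finite.coe_toFinset] at this
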